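/- Let f : ℝ^6 → ℝ be integrable on [0,2π]^6 and invariant under each of the transformations replacing one coordinate θₙ (n = 1,…,6) by π+θₙ or by π−θₙ. Then for every real β: ∫_{[0,2π]^6} f(θ) · ∏_{n ∈ ZMod 6} (1 + β cos(θₙ + θ_{n+1})) dθ = ∫_{[0,2π]^6} f(θ) · ( 1 + β^6·( ∏_{n=1}^{6} cos²θₙ + ∏_{n=1}^{6} sin²θₙ ) ) dθ, where indices are cyclic (θ₇ = θ₁). -/

import Mathlib

open MeasureTheory Real

/-- On `[0, 2π]`, the map `x ↦ 2π - x` preserves Lebesgue measure. -/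
lemma measurePreserving_two_pi_sub :
    MeasurePreserving (fun x : ℝ => 2 * π - x) (volume.restrict (Set.Icc 0 (2 * π)))
      (volume.restrict (Set.Icc 0 (2 * π))) := by
  have h := (Measure.measurePreserving_sub_left (volume : Measure ℝ) (2 * π)).restrict_preimage
    (measurableSet_Icc (a := (0 : ℝ)) (b := 2 * π))
  simpa using h

/-- The reflection `x ↦ π - x` modulo `2π`, with values in `[0, 2π]` for `x ∈ [0, 2π]`. -/
noncomputable def piSubMod (x : ℝ) : ℝ := if x ≤ π then π - x else 3 * π - x

lemma measurable_piSubMod : Measurable piSubMod :=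
  Measurable.ite measurableSet_Iic (by fun_prop) (by fun_prop)

lemma cos_piSubMod (x : ℝ) : cos (piSubMod x) = -cos x := by
  unfold piSubMod
  split_ifs
  · exact cos_pi_sub x
  · rw [show 3 * π - x = π - x + 2 * π by ring, cos_add_two_pi, cos_pi_sub]

/-- On `[0, 2π]`, the reflection `x ↦ π - x` modulo `2π` preserves Lebesgue measure. -/
lemma measurePreserving_piSubMod :
    MeasurePreserving piSubMod (volume.restrict (Set.Icc 0 (2 * π)))
      (volume.restrict (Set.Icc 0 (2 * π))) := by
  refine ⟨measurable_piSubMod, ?_⟩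
  have hsplit : (volume : Measure ℝ).restrict (Set.Icc 0 (2 * π)) =
      volume.restrict (Set.Icc 0 π) + volume.restrict (Set.Ioc π (2 * π)) := by
    rw [← Measure.restrict_union _ measurableSet_Ioc,
      Set.Icc_union_Ioc_eq_Icc pi_pos.le (by linarith [pi_pos])]
    exact Set.disjoint_left.2 fun x hx hx' => not_lt_of_ge hx.2 hx'.1
  have hleft : (volume.restrict (Set.Icc 0 π)).map piSubMod = volume.restrict (Set.Icc 0 π) := by
    have h := (Measure.measurePreserving_sub_left (volume : Measure ℝ) π).restrict_preimage
      (measurableSet_Icc (a := (0 : ℝ)) (b := π))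
    simp only [Set.preimage_const_sub_Icc, sub_self, sub_zero] at h
    rw [← Measure.map_congr, h.map_eq]
    filter_upwards [ae_restrict_mem measurableSet_Icc] with x hx
    simp [piSubMod, hx.2]
  have hright : (volume.restrict (Set.Ioc π (2 * π))).map piSubMod =
      volume.restrict (Set.Ioc π (2 * π)) := by
    have h := (Measure.measurePreserving_sub_left (volume : Measure ℝ) (3 * π)).restrict_preimage
      (measurableSet_Ico (a := π) (b := 2 * π))
    rw [Set.preimage_const_sub_Ico, show 3 * π - 2 * π = π by ring,
      show 3 * π - π = 2 * π by ring, restrict_Ico_eq_restrict_Ioc] at h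
    rw [← Measure.map_congr, h.map_eq]
    filter_upwards [ae_restrict_mem measurableSet_Ioc] with x hx
    simp [piSubMod, not_le.2 hx.1]
  rw [hsplit, Measure.map_add _ _ measurable_piSubMod, hleft, hright]

/-- Applying a measure-preserving map to a single coordinate preserves the product measure. -/
lemma measurePreserving_update {ι : Type*} [Fintype ι] [DecidableEq ι] {μ : Measure ℝ}
    [SigmaFinite μ] {r : ℝ → ℝ} (hr : MeasurePreserving r μ μ) (m : ι) :
    MeasurePreserving (fun θ : ι → ℝ => Function.update θ m (r (θ m)))
      (Measure.pi fun _ => μ) (Measure.pi fun _ => μ) := by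
  have h := measurePreserving_pi (fun _ : ι => μ) (fun _ => μ)
    (f := fun n => if n = m then r else id) fun n => by
      split_ifs
      · exact hr
      · exact MeasurePreserving.id μ
  convert h using 1
  ext θ n
  by_cases hn : n = m
  · subst hn; simp
  · simp [hn]

/-- A function which is odd under a measure-preserving map of one coordinate has integral `0`. -/
lemma integral_eq_zero_of_update_neg {ι : Type*} [Fintype ι] [DecidableEq ι] {μ : Measure ℝ}
    [SigmaFinite μ] {r : ℝ → ℝ} (hr : MeasurePreserving r μ μ) (m : ι) {F : (ι → ℝ) → ℝ}
    (hF : AEStronglyMeasurable F (Measure.pi fun _ => μ))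
    (hodd : ∀ θ, F (Function.update θ m (r (θ m))) = -F θ) :
    ∫ θ, F θ ∂(Measure.pi fun _ => μ) = 0 := by
  have hφ := measurePreserving_update hr m
  have h := integral_map hφ.measurable.aemeasurable (f := F) (by rwa [hφ.map_eq])
  rw [hφ.map_eq] at h
  simp only [hodd, integral_neg] at h
  linarith

/-- The three functions `1`, `cos`, `sin`. -/
noncomputable def trigFactor : Fin 3 → ℝ → ℝ := ![fun _ => 1, cos, sin]

lemma continuous_trigFactor (a : Fin 3) : Continuous (trigFactor a) := by
  fin_cases a
  · exact continuous_const
  · exact continuous_cos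
  · exact continuous_sin

lemma one_add_mul_cos_add (β x y : ℝ) :
    1 + β * cos (x + y) =
      ∑ a, ![1, β, -β] a * (trigFactor a x * trigFactor a y) := by
  simp [trigFactor, Fin.sum_univ_three, cos_add]
  ring

/-- Two distinct functions among `1`, `cos`, `sin` have a product which is odd under
`x ↦ 2π - x` or under `x ↦ π - x`. -/
lemma trigFactor_mul_odd {a b : Fin 3} (hab : a ≠ b) :
    (∀ x, trigFactor a (2 * π - x) * trigFactor b (2 * π - x) =
      -(trigFactor a x * trigFactor b x)) ∨
    (∀ x, trigFactor a (piSubMod x) * trigFactor b (piSubMod x) =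
      -(trigFactor a x * trigFactor b x)) := by
  fin_cases a <;> fin_cases b <;>
    solve
      | exact absurd rfl hab
      | left; intro x; simp [trigFactor, cos_two_pi_sub, sin_two_pi_sub]
      | right; intro x; simp [trigFactor, cos_piSubMod]

/-- The monomial attached to a choice `p` of one of the functions `1`, `cos`, `sin` on each edge
of a cycle. -/
noncomputable def cycleMonomial {N : ℕ} [NeZero N] (β : ℝ) (p : ZMod N → Fin 3)
    (θ : ZMod N → ℝ) : ℝ :=
  ∏ n, ![1, β, -β] (p n) * (trigFactor (p n) (θ n) * trigFactor (p n) (θ (n + 1)))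

lemma continuous_cycleMonomial {N : ℕ} [NeZero N] (β : ℝ) (p : ZMod N → Fin 3) :
    Continuous (cycleMonomial β p) := by
  refine continuous_finsetProd _ fun n _ => continuous_const.mul (.mul ?_ ?_)
  · exact (continuous_trigFactor _).comp (continuous_apply n)
  · exact (continuous_trigFactor _).comp (continuous_apply (n + 1))

lemma prod_one_add_mul_cos {N : ℕ} [NeZero N] (β : ℝ) (θ : ZMod N → ℝ) :
    ∏ n, (1 + β * cos (θ n + θ (n + 1))) = ∑ p, cycleMonomial β p θ := by
  simp only [one_add_mul_cos_add, cycleMonomial]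
  exact Fintype.prod_sum _

lemma cycleMonomial_eq_prod {N : ℕ} [NeZero N] (β : ℝ) (p : ZMod N → Fin 3)
    (θ : ZMod N → ℝ) :
    cycleMonomial β p θ = (∏ n, ![1, β, -β] (p n)) *
      ∏ n, (trigFactor (p (n - 1)) (θ n) * trigFactor (p n) (θ n)) := by
  have h : ∏ n, trigFactor (p n) (θ (n + 1)) = ∏ n, trigFactor (p (n - 1)) (θ n) :=
    Fintype.prod_equiv (Equiv.addRight 1) _ _ fun n => by simp
  simp only [cycleMonomial, Finset.prod_mul_distrib, h]
  ring

lemma cycleMonomial_update_neg {N : ℕ} [NeZero N] (β : ℝ) (p : ZMod N → Fin 3)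
    (m : ZMod N) {r : ℝ → ℝ}
    (hr : ∀ x, trigFactor (p (m - 1)) (r x) * trigFactor (p m) (r x) =
      -(trigFactor (p (m - 1)) x * trigFactor (p m) x)) (θ : ZMod N → ℝ) :
    cycleMonomial β p (Function.update θ m (r (θ m))) = -cycleMonomial β p θ := by
  rw [cycleMonomial_eq_prod, cycleMonomial_eq_prod,
    ← Finset.mul_prod_erase _ (fun n => trigFactor (p (n - 1)) (Function.update θ m (r (θ m)) n) *
      trigFactor (p n) (Function.update θ m (r (θ m)) n)) (Finset.mem_univ m),
    ← Finset.mul_prod_erase _ (fun n => trigFactor (p (n - 1)) (θ n) * trigFactor (p n) (θ n))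
      (Finset.mem_univ m), Function.update_self, hr]
  have h : ∏ n ∈ Finset.univ.erase m, (trigFactor (p (n - 1)) (Function.update θ m (r (θ m)) n) *
      trigFactor (p n) (Function.update θ m (r (θ m)) n)) =
      ∏ n ∈ Finset.univ.erase m, (trigFactor (p (n - 1)) (θ n) * trigFactor (p n) (θ n)) :=
    Finset.prod_congr rfl fun n hn => by
      rw [Function.update_of_ne (Finset.ne_of_mem_erase hn)]
  rw [h]
  ring

lemma exists_const_of_forall_sub_one {N : ℕ} [NeZero N] {α : Type*} {p : ZMod N → α}
    (h : ∀ n, p (n - 1) = p n) : ∃ a, Function.const _ a = p := by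
  have hk : ∀ k : ℕ, p k = p 0 := fun k => by
    induction k with
    | zero => simp
    | succ k ih => rw [← ih, ← h, Nat.cast_succ, add_sub_cancel_right]
  refine ⟨p 0, funext fun n => ?_⟩
  rw [Function.const_apply, ← hk n.val, ZMod.natCast_zmod_val]

/-- Integrals of non-constant monomials against an invariant function vanish. -/
lemma integral_mul_cycleMonomial_eq_zero {N : ℕ} [NeZero N] {f : (ZMod N → ℝ) → ℝ}
    (hf_int : IntegrableOn f (Set.univ.pi fun _ => Set.Icc (0 : ℝ) (2 * π)))
    (hf_plus : ∀ (θ : ZMod N → ℝ) (n : ZMod N), f (Function.update θ n (π + θ n)) = f θ)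
    (hf_minus : ∀ (θ : ZMod N → ℝ) (n : ZMod N), f (Function.update θ n (π - θ n)) = f θ)
    (β : ℝ) {p : ZMod N → Fin 3} (hp : ∀ a, Function.const _ a ≠ p) :
    ∫ θ in Set.univ.pi fun _ => Set.Icc (0 : ℝ) (2 * π), f θ * cycleMonomial β p θ = 0 := by
  obtain ⟨m, hm⟩ : ∃ m, p (m - 1) ≠ p m := by
    by_contra! h
    obtain ⟨a, ha⟩ := exists_const_of_forall_sub_one h
    exact hp a ha
  have hmeas := hf_int.aestronglyMeasurable.mul
    (continuous_cycleMonomial β p).aestronglyMeasurable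
  rw [volume_pi, Measure.restrict_pi_pi] at hmeas ⊢
  have hf_neg : ∀ (θ : ZMod N → ℝ) (n : ZMod N), f (Function.update θ n (2 * π - θ n)) = f θ :=
    fun θ n => by
      have h := hf_plus (Function.update θ n (π - θ n)) n
      rw [hf_minus, Function.update_self, Function.update_idem] at h
      rw [← h]
      congr 2
      ring
  have hf_piSubMod : ∀ (θ : ZMod N → ℝ) (n : ZMod N),
      f (Function.update θ n (piSubMod (θ n))) = f θ := fun θ n => by
    unfold piSubMod
    split_ifs
    · exact hf_minus θ n
    · have h := hf_plus (Function.update θ n (2 * π - θ n)) n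
      rw [hf_neg, Function.update_self, Function.update_idem] at h
      rw [← h]
      congr 2
      ring
  rcases trigFactor_mul_odd hm with h | h
  · refine integral_eq_zero_of_update_neg measurePreserving_two_pi_sub m hmeas fun θ => ?_
    rw [hf_neg, cycleMonomial_update_neg β p m h, mul_neg]
  · refine integral_eq_zero_of_update_neg measurePreserving_piSubMod m hmeas fun θ => ?_
    rw [hf_piSubMod, cycleMonomial_update_neg β p m h, mul_neg]

/-- **U(1) linearization identity on the hexagon with constant boundary
condition `σ ≡ +1`.** If `f : ℝ^6 → ℝ` is integrable on `[0,2π]^6` and invariant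
under replacing any coordinate `θₙ` by `π + θₙ` or by `π − θₙ`, then for every
real `β`:
`∫ f(θ)·∏ₙ (1 + β cos(θₙ+θₙ₊₁)) dθ = ∫ f(θ)·(1 + β⁶(∏ cos²θₙ + ∏ sin²θₙ)) dθ`,
with cyclic indices (`n ∈ ZMod 6`). -/
theorem stmt_12 (f : (ZMod 6 → ℝ) → ℝ)
    (hf_int : IntegrableOn f (Set.univ.pi (fun _ => Set.Icc (0:ℝ) (2*π))) volume)
    (hf_plus : ∀ (θ : ZMod 6 → ℝ) (n : ZMod 6),
      f (Function.update θ n (π + θ n)) = f θ)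
    (hf_minus : ∀ (θ : ZMod 6 → ℝ) (n : ZMod 6),
      f (Function.update θ n (π - θ n)) = f θ)
    (β : ℝ) :
    (∫ θ : ZMod 6 → ℝ in Set.univ.pi (fun _ => Set.Icc (0:ℝ) (2*π)),
      f θ * ∏ n : ZMod 6, (1 + β * cos (θ n + θ (n + 1))))
    = ∫ θ : ZMod 6 → ℝ in Set.univ.pi (fun _ => Set.Icc (0:ℝ) (2*π)),
      f θ * (1 + β ^ 6 *
        ((∏ n : ZMod 6, cos (θ n) ^ 2) + (∏ n : ZMod 6, sin (θ n) ^ 2))) := by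
  have hint : ∀ p : ZMod 6 → Fin 3, IntegrableOn (fun θ => f θ * cycleMonomial β p θ)
      (Set.univ.pi fun _ => Set.Icc (0 : ℝ) (2 * π)) := fun p =>
    hf_int.mul_continuousOn (continuous_cycleMonomial β p).continuousOn
      (isCompact_univ_pi fun _ => isCompact_Icc)
  have hconst : ∀ θ : ZMod 6 → ℝ, 1 + β ^ 6 *
      ((∏ n : ZMod 6, cos (θ n) ^ 2) + (∏ n : ZMod 6, sin (θ n) ^ 2)) =
      ∑ a, cycleMonomial β (Function.const _ a) θ := fun θ => by
    simp only [Fin.sum_univ_three, cycleMonomial_eq_prod, Function.const_apply,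
      Finset.prod_const, Finset.card_univ, ZMod.card, ← pow_two]
    simp [trigFactor, Even.neg_pow (show Even 6 by decide)]
    ring
  simp only [prod_one_add_mul_cos, hconst, Finset.mul_sum]
  rw [integral_finsetSum _ fun p _ => hint p, integral_finsetSum _ fun a _ => hint _]
  symm
  rw [← Finset.sum_image (s := Finset.univ) (g := Function.const (ZMod 6))
    (f := fun p => ∫ θ in Set.univ.pi fun _ => Set.Icc (0 : ℝ) (2 * π), f θ * cycleMonomial β p θ)
    Function.const_injective.injOn]
  refine Finset.sum_subset (Finset.subset_univ _) fun p _ hp => ?_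
  exact integral_mul_cycleMonomial_eq_zero hf_int hf_plus hf_minus β fun a ha =>
    hp (Finset.mem_image.2 ⟨a, Finset.mem_univ a, ha⟩)
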